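/- Let 𝓗 be a well-structured preconditioner set in dimension d and let x_1,…,x_{T+1}, g_t, M_t, H_t be AdaReg iterates with preconditioner set 𝓗, parameters ε > 0 and η > 0, convex set 𝒳, and differentiable convex losses L_1,…,L_T. Then for every x* ∈ 𝒳: Σ_{t=1}^T L_t(x_t) − Σ_{t=1}^T L_t(x*) ≤ (D²/(2η) + η)·(G + d·√ε), where D = max_{1≤t≤T} ‖x_t − x*‖_𝓗 and G = |||g_{1:T}|||_𝓗. -/

import Mathlib

open Matrix

/-- A set of real `d × d` matrices closed under scalar multiplication, addition and
matrix multiplication, containing the identity. -/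
def IsMatrixSubalgebra {d : ℕ} (K : Set (Matrix (Fin d) (Fin d) ℝ)) : Prop :=
  (∀ (c : ℝ), ∀ A ∈ K, c • A ∈ K) ∧ (∀ A ∈ K, ∀ B ∈ K, A + B ∈ K) ∧
    (∀ A ∈ K, ∀ B ∈ K, A * B ∈ K) ∧ (1 : Matrix (Fin d) (Fin d) ℝ) ∈ K

/-- A well-structured preconditioner set: `𝓗 = 𝒦 ∩ S₊^d` for a matrix subalgebra `𝒦`. -/
def WellStructured {d : ℕ} (𝓗 : Set (Matrix (Fin d) (Fin d) ℝ)) : Prop :=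
  ∃ K : Set (Matrix (Fin d) (Fin d) ℝ),
    IsMatrixSubalgebra K ∧ 𝓗 = K ∩ {M | M.PosSemidef}

/-- `⟨A,B⟩ := Tr(Aᵀ B)` for square real matrices. -/
noncomputable def minner {n : Type*} [Fintype n] (A B : Matrix n n ℝ) : ℝ := (Aᵀ * B).trace

/-- The `𝓗`-norm `‖x‖_𝓗 = sup{√(xᵀHx) : H ∈ 𝓗, Tr(H) ≤ 1}`. -/
noncomputable def hNorm {d : ℕ} (𝓗 : Set (Matrix (Fin d) (Fin d) ℝ)) (x : Fin d → ℝ) : ℝ :=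
  sSup {r | ∃ H ∈ 𝓗, H.trace ≤ 1 ∧ r = Real.sqrt (x ⬝ᵥ H.mulVec x)}

/-- The adaptive gradient norm `|||g_{1:T}|||_𝓗`. -/
noncomputable def adaNorm {d : ℕ} (𝓗 : Set (Matrix (Fin d) (Fin d) ℝ)) (T : ℕ)
    (g : ℕ → Fin d → ℝ) : ℝ :=
  sInf {r | ∃ H ∈ 𝓗, H.PosDef ∧ H.trace ≤ 1 ∧
    r = Real.sqrt (∑ s ∈ Finset.Icc 1 T, g s ⬝ᵥ H⁻¹.mulVec (g s))}

/-- The gradient of `f : ℝ^d → ℝ` at `x`, componentwise. -/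
noncomputable def grad {d : ℕ} (f : (Fin d → ℝ) → ℝ) (x : Fin d → ℝ) : Fin d → ℝ :=
  fun i => fderiv ℝ f x (Pi.single i 1)

/-- AdaReg iterates (Algorithm 1) with preconditioner set `𝓗`, parameters `ε, η`,
constraint set `𝒳` and differentiable convex losses `L 1, …, L T`. -/
def AdaReg {d : ℕ} (𝓗 : Set (Matrix (Fin d) (Fin d) ℝ)) (ε η : ℝ)
    (𝒳 : Set (Fin d → ℝ)) (T : ℕ) (L : ℕ → (Fin d → ℝ) → ℝ)
    (x g : ℕ → Fin d → ℝ) (M H : ℕ → Matrix (Fin d) (Fin d) ℝ) : Prop :=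
  x 1 ∈ 𝒳 ∧ M 0 = ε • (1 : Matrix (Fin d) (Fin d) ℝ) ∧
  ∀ t, 1 ≤ t → t ≤ T →
    Differentiable ℝ (L t) ∧ ConvexOn ℝ Set.univ (L t) ∧
    g t = grad (L t) (x t) ∧
    M t = M (t - 1) + Matrix.vecMulVec (g t) (g t) ∧
    H t ∈ 𝓗 ∧ (H t).PosDef ∧
    (∀ H' ∈ 𝓗, H'.PosDef →
      minner (M t) (H t)⁻¹ + η ^ 2 * (H t).trace ≤ minner (M t) H'⁻¹ + η ^ 2 * H'.trace) ∧
    x (t + 1) ∈ 𝒳 ∧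
    (∀ y ∈ 𝒳,
      (x (t + 1) - (x t - (H t)⁻¹.mulVec (g t))) ⬝ᵥ
          (H t).mulVec (x (t + 1) - (x t - (H t)⁻¹.mulVec (g t))) ≤
      (y - (x t - (H t)⁻¹.mulVec (g t))) ⬝ᵥ
          (H t).mulVec (y - (x t - (H t)⁻¹.mulVec (g t))))

namespace Matrix

section SubalgebraClosure

variable {n : Type*} [Fintype n] [DecidableEq n]

/-- A symmetric real matrix has finite spectrum, so its functional calculus is polynomial. -/
theorem cfc_mem_subalgebra (S : Subalgebra ℝ (Matrix n n ℝ)) {C : Matrix n n ℝ}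
    (hC : C.IsHermitian) (hCS : C ∈ S) (f : ℝ → ℝ) : cfc f C ∈ S := by
  have hfin : (spectrum ℝ C).Finite := Matrix.finite_real_spectrum
  have hsa : IsSelfAdjoint C := hC.isSelfAdjoint
  have key : cfc f C = Polynomial.aeval C (Lagrange.interpolate hfin.toFinset id f) := by
    rw [← cfc_polynomial (p := IsSelfAdjoint) _ C hsa]
    refine cfc_congr fun x hx => ?_
    exact (Lagrange.eval_interpolate_at_node (v := id) f Function.injective_id.injOn
      (hfin.mem_toFinset.2 hx)).symm
  rw [key]
  exact Algebra.adjoin_le (Set.singleton_subset_iff.2 hCS)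
    (Polynomial.aeval_mem_adjoin_singleton ℝ C)

theorem PosDef.inv_mem_subalgebra {S : Subalgebra ℝ (Matrix n n ℝ)} {P : Matrix n n ℝ}
    (hP : P.PosDef) (hPS : P ∈ S) : P⁻¹ ∈ S := by
  obtain ⟨u, hu⟩ := hP.isUnit
  have h := cfc_mem_subalgebra S hP.isHermitian hPS (fun x => x⁻¹)
  rw [← hu] at h ⊢
  rw [cfc_inv_id (R := ℝ) (p := IsSelfAdjoint) u (by rw [hu]; exact hP.isHermitian.isSelfAdjoint)]
    at h
  rwa [← Matrix.coe_units_inv]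

/-- Decomposition of a symmetric matrix into positive and negative part, the latter given as
the square of an element `R` of any subalgebra containing the matrix. -/
theorem IsHermitian.exists_negPart_sqrt (S : Subalgebra ℝ (Matrix n n ℝ)) {C : Matrix n n ℝ}
    (hC : C.IsHermitian) (hCS : C ∈ S) :
    ∃ R ∈ S, R.IsHermitian ∧ C * (R * R) = -((R * R) * (R * R)) ∧
      (R * R) * C = -((R * R) * (R * R)) ∧ (C + R * R).PosSemidef := by
  have hfin : (spectrum ℝ C).Finite := Matrix.finite_real_spectrum
  have hsa : IsSelfAdjoint C := hC.isSelfAdjoint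
  have hcont : ∀ f : ℝ → ℝ, ContinuousOn f (spectrum ℝ C) := fun f => hfin.continuousOn f
  have hmul : ∀ f h : ℝ → ℝ, cfc f C * cfc h C = cfc (fun x => f x * h x) C := fun f h =>
    (cfc_mul f h C (hcont _) (hcont _)).symm
  have hid : cfc (fun x : ℝ => x) C = C := cfc_id' ℝ C hsa
  have hherm : ∀ f : ℝ → ℝ, (cfc f C).IsHermitian := fun f =>
    (cfc_predicate (p := IsSelfAdjoint) f C).isHermitian
  set r : ℝ → ℝ := fun x => √(max (-x) 0) with hr
  set q : ℝ → ℝ := fun x => √(max x 0) with hq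
  have hrr : ∀ x, r x * r x = max (-x) 0 := fun x => Real.mul_self_sqrt (le_max_right _ _)
  have hqq : ∀ x, q x * q x = max x 0 := fun x => Real.mul_self_sqrt (le_max_right _ _)
  have hx : ∀ x : ℝ, x * max (-x) 0 = -(max (-x) 0 * max (-x) 0) := fun x => by
    rcases le_total x 0 with h | h
    · rw [max_eq_left (by linarith)]; ring
    · rw [max_eq_right (by linarith)]; ring
  have hC2 : C * (cfc r C * cfc r C) = -((cfc r C * cfc r C) * (cfc r C * cfc r C)) := by
    nth_rw 1 [← hid]
    rw [hmul, hmul, hmul, ← cfc_neg]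
    refine cfc_congr fun x _ => ?_
    simp only [hrr, hx]
  have hcomm : (cfc r C * cfc r C) * C = C * (cfc r C * cfc r C) := by
    nth_rw 3 [← hid]
    nth_rw 4 [← hid]
    rw [hmul, hmul, hmul]
    exact cfc_congr fun x _ => mul_comm _ _
  refine ⟨cfc r C, cfc_mem_subalgebra S hC hCS r, hherm r, hC2, hcomm.trans hC2, ?_⟩
  have : C + cfc r C * cfc r C = (cfc q C)ᴴ * cfc q C := by
    rw [(hherm q).eq]
    nth_rw 1 [← hid]
    rw [hmul, hmul, ← cfc_add C (fun x : ℝ => x) _ (hcont _) (hcont _)]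
    refine cfc_congr fun x _ => ?_
    simp only [hrr, hqq]
    rcases le_total x 0 with h | h
    · rw [max_eq_left (by linarith), max_eq_right h]; ring
    · rw [max_eq_right (by linarith), max_eq_left h]; ring
  rw [this]
  exact posSemidef_conjTranspose_mul_self _

end SubalgebraClosure

end Matrix

namespace Matrix

section Inverse

variable {n : Type*} [Fintype n] [DecidableEq n]

theorem PosDef.inv_sub_inv_add {P Q : Matrix n n ℝ} (hP : P.PosDef) (hPQ : (P + Q).PosDef) :
    P⁻¹ - (P + Q)⁻¹ = (P + Q)⁻¹ * Q * P⁻¹ := by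
  have h1 := (isUnit_iff_isUnit_det P).1 hP.isUnit
  have h2 := (isUnit_iff_isUnit_det (P + Q)).1 hPQ.isUnit
  have h3 : (P + Q)⁻¹ * (P + Q) * P⁻¹ = P⁻¹ := by rw [nonsing_inv_mul _ h2, one_mul]
  rw [mul_add, add_mul, mul_nonsing_inv_cancel_right _ _ h1] at h3
  rw [sub_eq_iff_eq_add, add_comm, h3]

/-- Matrix inversion is antitone for the Loewner order. -/
theorem PosDef.posSemidef_inv_sub_inv_add {P Q : Matrix n n ℝ} (hP : P.PosDef)
    (hQ : Q.PosSemidef) : (P⁻¹ - (P + Q)⁻¹).PosSemidef := by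
  have hPQ := hP.add_posSemidef hQ
  have h2 := (isUnit_iff_isUnit_det (P + Q)).1 hPQ.isUnit
  have hsum : (Q + Qᴴ * P⁻¹ * Q).PosSemidef :=
    hQ.add (hP.inv.posSemidef.conjTranspose_mul_mul_same Q)
  have h := hsum.mul_mul_conjTranspose_same (P + Q)⁻¹
  rw [hPQ.inv.isHermitian.eq, hQ.isHermitian.eq] at h
  convert h using 1
  have h1 := (isUnit_iff_isUnit_det P).1 hP.isUnit
  have h3 : Q + Q * P⁻¹ * Q = Q * P⁻¹ * (P + Q) := by
    rw [mul_add, nonsing_inv_mul_cancel_right _ _ h1]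
  rw [hP.inv_sub_inv_add hPQ, h3, ← mul_assoc, mul_nonsing_inv_cancel_right _ _ h2, ← mul_assoc]

theorem continuousAt_inv_of_isUnit_det {P : Matrix n n ℝ} (hP : IsUnit P.det) :
    ContinuousAt (fun X : Matrix n n ℝ => X⁻¹) P := by
  simp only [Matrix.inv_def, Ring.inverse_eq_inv']
  exact ((continuous_id.matrix_det).continuousAt.inv₀ hP.ne_zero).smul
    (continuous_id.matrix_adjugate).continuousAt

/-- One-sided first order condition for a linear trace functional of the inverse. -/
theorem PosDef.trace_mul_inv_mul_inv_le {P A W : Matrix n n ℝ} {b : ℝ} (hP : P.PosDef)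
    (hA : A.PosSemidef)
    (h : ∀ s : ℝ, 0 < s → (W * P⁻¹).trace ≤ s * b + (W * (P + s • A)⁻¹).trace) :
    (W * (P⁻¹ * A * P⁻¹)).trace ≤ b := by
  have hbound : ∀ s : ℝ, 0 < s → (W * ((P + s • A)⁻¹ * A * P⁻¹)).trace ≤ b := by
    intro s hs
    have hid := hP.inv_sub_inv_add (hP.add_posSemidef (hA.smul hs.le))
    have h1 := congrArg (fun X => (W * X).trace) hid
    simp only [mul_sub, trace_sub, Matrix.mul_smul, Matrix.smul_mul, trace_smul, smul_eq_mul] at h1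
    have h2 := h s hs
    have h3 : s * (W * ((P + s • A)⁻¹ * A * P⁻¹)).trace ≤ s * b := by linarith
    exact le_of_mul_le_mul_left h3 hs
  have hcont : ContinuousAt (fun s : ℝ => (W * ((P + s • A)⁻¹ * A * P⁻¹)).trace) 0 := by
    have h0 : ContinuousAt (fun s : ℝ => (P + s • A)⁻¹) 0 := by
      refine ContinuousAt.comp (f := fun s : ℝ => P + s • A) (g := fun X => X⁻¹) ?_
        (by fun_prop)
      simpa using continuousAt_inv_of_isUnit_det ((isUnit_iff_isUnit_det P).1 hP.isUnit)
    have hlin : Continuous fun X : Matrix n n ℝ => (W * (X * A * P⁻¹)).trace := by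
      fun_prop
    exact hlin.continuousAt.comp h0
  have hlim := hcont.tendsto.mono_left (nhdsWithin_le_nhds (s := Set.Ioi 0))
  simp only [zero_smul, add_zero] at hlim
  exact le_of_tendsto hlim (Filter.eventually_of_mem self_mem_nhdsWithin hbound)

end Inverse

section QuadraticForm

variable {n : Type*} [Fintype n]

theorem trace_vecMulVec_mul (v w : n → ℝ) (A : Matrix n n ℝ) :
    (vecMulVec v w * A).trace = w ⬝ᵥ A *ᵥ v := by
  rw [vecMulVec_mul, trace_vecMulVec, dotProduct_comm, dotProduct_mulVec]

theorem PosSemidef.quadForm_nonneg {A : Matrix n n ℝ} (hA : A.PosSemidef) (v : n → ℝ) :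
    0 ≤ v ⬝ᵥ A *ᵥ v := by
  simpa using hA.dotProduct_mulVec_nonneg v

theorem IsHermitian.dotProduct_mulVec_comm {A : Matrix n n ℝ} (hA : A.IsHermitian)
    (v w : n → ℝ) : v ⬝ᵥ A *ᵥ w = w ⬝ᵥ A *ᵥ v := by
  have hT : Aᵀ = A := by simpa [conjTranspose_eq_transpose_of_trivial] using hA.eq
  rw [dotProduct_mulVec, ← mulVec_transpose, hT, dotProduct_comm]

theorem PosSemidef.quadForm_le_trace_mul {A : Matrix n n ℝ} (hA : A.PosSemidef) (v : n → ℝ) :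
    v ⬝ᵥ A *ᵥ v ≤ A.trace * (v ⬝ᵥ v) := by
  obtain ⟨m, u, rfl⟩ := posSemidef_iff_eq_sum_vecMulVec.1 hA
  simp only [sum_mulVec, dotProduct_sum, trace_sum, Finset.sum_mul]
  refine Finset.sum_le_sum fun i _ => ?_
  simp only [vecMulVec_mulVec, trace_vecMulVec, star_trivial]
  have h := Finset.sum_mul_sq_le_sq_mul_sq Finset.univ (u i) v
  simp only [dotProduct, Pi.smul_apply, MulOpposite.smul_eq_mul_unop, MulOpposite.unop_op] at h ⊢
  calc _ = (∑ j, u i j * v j) ^ 2 := by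
        rw [sq, Finset.sum_mul]
        exact Finset.sum_congr rfl fun j _ => by ring
    _ ≤ _ := h
    _ = _ := by simp only [sq]

end QuadraticForm

/-- If `X ^ 2 - Y ^ 2` pairs nonnegatively with the positive semidefinite elements of a subalgebra
containing `X` and `Y`, then `Y ≤ X` in the Loewner order. -/
theorem PosDef.posSemidef_sub_of_trace_nonneg {n : Type*} [Fintype n] [DecidableEq n]
    {S : Subalgebra ℝ (Matrix n n ℝ)} {X Y : Matrix n n ℝ} (hX : X.PosDef) (hY : Y.PosDef)
    (hXS : X ∈ S) (hYS : Y ∈ S)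
    (h : ∀ A ∈ S, A.PosSemidef → (Y * A * Y).trace ≤ (X * A * X).trace) :
    (X - Y).PosSemidef := by
  obtain ⟨R, hRS, hR, h1, h2, h3⟩ :=
    (hX.isHermitian.sub hY.isHermitian).exists_negPart_sqrt S (sub_mem hXS hYS)
  set N := R * R with hN
  have hNherm : Nᴴ = N := by rw [hN, conjTranspose_mul, hR.eq]
  have hNpsd : N.PosSemidef := by
    have := posSemidef_conjTranspose_mul_self R
    rwa [hR.eq] at this
  have h4 := h N (mul_mem hRS hRS) hNpsd
  have hpsd : (Nᴴ * (X + Y) * N).PosSemidef :=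
    (hX.add hY).posSemidef.conjTranspose_mul_mul_same N
  have htr : 2 * (Nᴴ * (X + Y) * N).trace = -(2 * ((X * N * X).trace - (Y * N * Y).trace)) := by
    have e1 : ((X + Y) * ((X - Y) * N)).trace = -(N * (X + Y) * N).trace := by
      rw [h1, mul_neg, trace_neg, mul_assoc N, trace_mul_comm N, mul_assoc (X + Y)]
    have e2 : ((X + Y) * (N * (X - Y))).trace = -(N * (X + Y) * N).trace := by
      rw [h2, mul_neg, trace_neg, mul_assoc N, trace_mul_comm N, mul_assoc (X + Y)]
    have e3 : ((X + Y) * ((X - Y) * N)).trace + ((X + Y) * (N * (X - Y))).trace =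
        2 * ((X * N * X).trace - (Y * N * Y).trace) := by
      have c1 : (X * (X * N)).trace = (X * N * X).trace := trace_mul_comm _ _
      have c2 : (Y * (Y * N)).trace = (Y * N * Y).trace := trace_mul_comm _ _
      have c3 : (X * (Y * N)).trace = (Y * (N * X)).trace := by
        rw [trace_mul_comm, mul_assoc]
      have c4 : (Y * (X * N)).trace = (X * (N * Y)).trace := by
        rw [trace_mul_comm, mul_assoc]
      simp only [add_mul, sub_mul, mul_sub, trace_add, trace_sub, c1, c2, c3, c4,
        ← mul_assoc X N X, ← mul_assoc Y N Y]
      ring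
    rw [hNherm]
    linarith
  have hzero : (Nᴴ * (X + Y) * N) = 0 :=
    hpsd.trace_eq_zero_iff.1 (le_antisymm (by linarith) hpsd.trace_nonneg)
  have hN0 : N = 0 := by
    refine ext_of_mulVec_single fun i => ?_
    by_contra hne
    rw [zero_mulVec] at hne
    have hpos := (hX.add hY).dotProduct_mulVec_pos hne
    have : star (N *ᵥ Pi.single i 1) ⬝ᵥ (X + Y) *ᵥ (N *ᵥ Pi.single i 1) =
        Pi.single i 1 ⬝ᵥ (Nᴴ * (X + Y) * N) *ᵥ Pi.single i 1 := by
      rw [star_mulVec, ← dotProduct_mulVec, mulVec_mulVec, mulVec_mulVec, ← mul_assoc]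
      simp
    rw [this, hzero] at hpos
    simp at hpos
  rwa [hN0, add_zero] at h3

end Matrix

section HNorm

theorem IsMatrixSubalgebra.exists_subalgebra {d : ℕ} {K : Set (Matrix (Fin d) (Fin d) ℝ)}
    (hK : IsMatrixSubalgebra K) :
    ∃ S : Subalgebra ℝ (Matrix (Fin d) (Fin d) ℝ), ∀ A, A ∈ S ↔ A ∈ K := by
  obtain ⟨hsmul, hadd, hmul, hone⟩ := hK
  refine ⟨{ carrier := K
            mul_mem' := fun ha hb => hmul _ ha _ hb
            add_mem' := fun ha hb => hadd _ ha _ hb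
            algebraMap_mem' := fun r => ?_ }, fun A => Iff.rfl⟩
  rw [Algebra.algebraMap_eq_smul_one]
  exact hsmul r _ hone

theorem WellStructured.exists_subalgebra {d : ℕ} {𝓗 : Set (Matrix (Fin d) (Fin d) ℝ)}
    (h𝓗 : WellStructured 𝓗) :
    ∃ S : Subalgebra ℝ (Matrix (Fin d) (Fin d) ℝ), ∀ A, A ∈ 𝓗 ↔ A ∈ S ∧ A.PosSemidef := by
  obtain ⟨K, hK, rfl⟩ := h𝓗
  obtain ⟨S, hS⟩ := hK.exists_subalgebra
  exact ⟨S, fun A => by rw [hS]; rfl⟩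

theorem hNorm_nonneg {d : ℕ} (𝓗 : Set (Matrix (Fin d) (Fin d) ℝ)) (v : Fin d → ℝ) :
    0 ≤ hNorm 𝓗 v := by
  refine Real.sSup_nonneg ?_
  rintro r ⟨A, -, -, rfl⟩
  exact Real.sqrt_nonneg _

theorem WellStructured.sqrt_quadForm_le_hNorm {d : ℕ} {𝓗 : Set (Matrix (Fin d) (Fin d) ℝ)}
    (h𝓗 : WellStructured 𝓗) {A : Matrix (Fin d) (Fin d) ℝ} (hA : A ∈ 𝓗) (htr : A.trace ≤ 1)
    (v : Fin d → ℝ) : √(v ⬝ᵥ A *ᵥ v) ≤ hNorm 𝓗 v := by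
  obtain ⟨K, -, rfl⟩ := h𝓗
  refine le_csSup ⟨√(v ⬝ᵥ v), ?_⟩ ⟨A, hA, htr, rfl⟩
  rintro r ⟨B, hB, hBtr, rfl⟩
  refine Real.sqrt_le_sqrt ((hB.2.quadForm_le_trace_mul v).trans ?_)
  exact mul_le_of_le_one_left (Finset.sum_nonneg fun i _ => mul_self_nonneg (v i)) hBtr

theorem WellStructured.quadForm_le_trace_mul_hNorm_sq {d : ℕ}
    {𝓗 : Set (Matrix (Fin d) (Fin d) ℝ)} (h𝓗 : WellStructured 𝓗)
    {A : Matrix (Fin d) (Fin d) ℝ} (hA : A ∈ 𝓗) (v : Fin d → ℝ) :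
    v ⬝ᵥ A *ᵥ v ≤ A.trace * hNorm 𝓗 v ^ 2 := by
  obtain ⟨S, hS⟩ := h𝓗.exists_subalgebra
  obtain ⟨hAS, hpsd⟩ := (hS A).1 hA
  rcases hpsd.trace_nonneg.eq_or_lt with h0 | hpos
  · have := hpsd.quadForm_le_trace_mul v
    rw [← h0, zero_mul] at this ⊢
    exact this
  · have hB : A.trace⁻¹ • A ∈ 𝓗 :=
      (hS _).2 ⟨S.smul_mem hAS _, hpsd.smul (inv_nonneg.2 hpos.le)⟩
    have htr : (A.trace⁻¹ • A).trace ≤ 1 := by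
      rw [Matrix.trace_smul, smul_eq_mul, inv_mul_cancel₀ hpos.ne']
    have h := h𝓗.sqrt_quadForm_le_hNorm hB htr v
    rw [Real.sqrt_le_left (hNorm_nonneg 𝓗 v), Matrix.smul_mulVec, dotProduct_smul, smul_eq_mul,
      inv_mul_le_iff₀ hpos] at h
    exact h

end HNorm

section Regularizer

variable {d : ℕ} {S : Subalgebra ℝ (Matrix (Fin d) (Fin d) ℝ)} {η : ℝ}
  {M H : Matrix (Fin d) (Fin d) ℝ}

/-- First order optimality: `η² H²` is the projection of `M` onto the symmetric part of `S`. -/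
theorem minner_eq_of_isMin (hH : H.PosDef) (hHS : H ∈ S)
    (hmin : ∀ H' ∈ S, H'.PosDef →
      minner M H⁻¹ + η ^ 2 * H.trace ≤ minner M H'⁻¹ + η ^ 2 * H'.trace)
    {A : Matrix (Fin d) (Fin d) ℝ} (hA : A.PosSemidef) (hAS : A ∈ S) :
    minner M A = η ^ 2 * (H * A * H).trace := by
  have hdet := (isUnit_iff_isUnit_det H).1 hH.isUnit
  apply le_antisymm
  · have hB : (H * A * H).PosSemidef := by
      simpa only [hH.isHermitian.eq] using hA.mul_mul_conjTranspose_same H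
    have hBS : H * A * H ∈ S := mul_mem (mul_mem hHS hAS) hHS
    have h := hH.trace_mul_inv_mul_inv_le (W := Mᵀ) (b := η ^ 2 * (H * A * H).trace) hB
      fun s hs => by
        have h1 := hmin (H + s • (H * A * H)) (add_mem hHS (S.smul_mem hBS s))
          (hH.add_posSemidef (hB.smul hs.le))
        simp only [minner, trace_add, trace_smul, smul_eq_mul] at h1
        linarith
    have e : H⁻¹ * (H * A * H) * H⁻¹ = A := by
      rw [mul_assoc H, nonsing_inv_mul_cancel_left _ _ hdet, mul_nonsing_inv_cancel_right _ _ hdet]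
    rwa [e] at h
  · have h := hH.inv.trace_mul_inv_mul_inv_le (W := η ^ 2 • (1 : Matrix (Fin d) (Fin d) ℝ))
      (b := minner M A) hA fun s hs => by
        have hP := hH.inv.add_posSemidef (hA.smul hs.le)
        have hPS : H⁻¹ + s • A ∈ S := add_mem (hH.inv_mem_subalgebra hHS) (S.smul_mem hAS s)
        have h1 := hmin _ (hP.inv_mem_subalgebra hPS) hP.inv
        rw [nonsing_inv_nonsing_inv _ ((isUnit_iff_isUnit_det _).1 hP.isUnit)] at h1
        simp only [minner, mul_add, trace_add, trace_smul, smul_eq_mul, Matrix.mul_smul,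
          Matrix.smul_mul, one_mul, nonsing_inv_nonsing_inv _ hdet] at h1 ⊢
        linarith
    simpa only [nonsing_inv_nonsing_inv _ hdet, Matrix.smul_mul, one_mul, trace_smul,
      smul_eq_mul] using h

theorem minner_inv_eq_of_isMin (hH : H.PosDef) (hHS : H ∈ S)
    (hmin : ∀ H' ∈ S, H'.PosDef →
      minner M H⁻¹ + η ^ 2 * H.trace ≤ minner M H'⁻¹ + η ^ 2 * H'.trace) :
    minner M H⁻¹ = η ^ 2 * H.trace := by
  rw [minner_eq_of_isMin hH hHS hmin hH.inv.posSemidef (hH.inv_mem_subalgebra hHS),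
    mul_nonsing_inv _ ((isUnit_iff_isUnit_det H).1 hH.isUnit), one_mul]

theorem minner_vecMulVec_self (v : Fin d → ℝ) (A : Matrix (Fin d) (Fin d) ℝ) :
    minner (vecMulVec v v) A = v ⬝ᵥ A *ᵥ v := by
  rw [minner, transpose_vecMulVec, trace_vecMulVec_mul]

theorem minner_add_left (A B C : Matrix (Fin d) (Fin d) ℝ) :
    minner (A + B) C = minner A C + minner B C := by
  simp [minner, add_mul]

/-- The regularized minimizers increase in the Loewner order. -/
theorem posSemidef_sub_of_isMin {M' H' : Matrix (Fin d) (Fin d) ℝ} {v : Fin d → ℝ} (hη : 0 < η)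
    (hM : M' = M + vecMulVec v v) (hH : H.PosDef) (hHS : H ∈ S) (hH' : H'.PosDef) (hHS' : H' ∈ S)
    (hmin : ∀ B ∈ S, B.PosDef →
      minner M H⁻¹ + η ^ 2 * H.trace ≤ minner M B⁻¹ + η ^ 2 * B.trace)
    (hmin' : ∀ B ∈ S, B.PosDef →
      minner M' H'⁻¹ + η ^ 2 * H'.trace ≤ minner M' B⁻¹ + η ^ 2 * B.trace) :
    (H' - H).PosSemidef := by
  refine hH'.posSemidef_sub_of_trace_nonneg hH hHS' hHS fun A hAS hA => ?_
  have h1 := minner_eq_of_isMin hH hHS hmin hA hAS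
  have h2 := minner_eq_of_isMin hH' hHS' hmin' hA hAS
  rw [hM, minner_add_left, minner_vecMulVec_self] at h2
  have h3 := hA.quadForm_nonneg v
  exact le_of_mul_le_mul_left (by linarith) (pow_pos hη 2)

/-- Bound on the trace of the regularized minimizer, by comparison with `a • H₀ + b • 1`. -/
theorem trace_le_of_isMin {ι : Type*} {s : Finset ι} {g : ι → Fin d → ℝ} {ε : ℝ} (hε : 0 < ε)
    (hη : 0 < η) (hM : ∀ A, minner M A = ε * A.trace + ∑ i ∈ s, g i ⬝ᵥ A *ᵥ g i)
    (hH : H.PosDef) (hHS : H ∈ S)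
    (hmin : ∀ H' ∈ S, H'.PosDef →
      minner M H⁻¹ + η ^ 2 * H.trace ≤ minner M H'⁻¹ + η ^ 2 * H'.trace)
    {H₀ : Matrix (Fin d) (Fin d) ℝ} (hH₀ : H₀.PosDef) (hHS₀ : H₀ ∈ S) (htr : H₀.trace ≤ 1) :
    η * H.trace ≤ √(∑ i ∈ s, g i ⬝ᵥ H₀⁻¹ *ᵥ g i) + d * √ε := by
  set q := ∑ i ∈ s, g i ⬝ᵥ H₀⁻¹ *ᵥ g i with hq
  have hq0 : 0 ≤ q := Finset.sum_nonneg fun i _ => hH₀.inv.posSemidef.quadForm_nonneg _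
  suffices hsuff : ∀ r, √q < r → η * H.trace ≤ r + d * √ε by
    have : ∀ r, √q < r → η * H.trace - d * √ε ≤ r := fun r hr => by linarith [hsuff r hr]
    linarith [le_of_forall_gt_imp_ge_of_dense this]
  intro r hr
  have hr0 : 0 < r := (Real.sqrt_nonneg q).trans_lt hr
  have hqr : q ≤ r ^ 2 := (Real.sqrt_le_left hr0.le).1 hr.le
  have hsε : 0 < √ε := Real.sqrt_pos.2 hε
  set a := r / η with ha
  set b := √ε / η with hb
  have ha0 : 0 < a := div_pos hr0 hη
  have hb0 : 0 < b := div_pos hsε hη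
  have hP : (a • H₀).PosDef := hH₀.smul ha0
  have hQ : (b • (1 : Matrix (Fin d) (Fin d) ℝ)).PosDef := PosDef.one.smul hb0
  have h1 := hmin (a • H₀ + b • 1) (add_mem (S.smul_mem hHS₀ a) (S.smul_mem (one_mem S) b))
    (hP.add hQ)
  rw [minner_inv_eq_of_isMin hH hHS hmin, hM] at h1
  have hquad : ∑ i ∈ s, g i ⬝ᵥ (a • H₀ + b • 1)⁻¹ *ᵥ g i ≤ a⁻¹ * q := by
    rw [hq, Finset.mul_sum]
    refine Finset.sum_le_sum fun i _ => ?_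
    have h := (hP.posSemidef_inv_sub_inv_add hQ.posSemidef).quadForm_nonneg (g i)
    have e : (a • H₀)⁻¹ = a⁻¹ • H₀⁻¹ :=
      Matrix.inv_smul' H₀ (Units.mk0 a ha0.ne') ((isUnit_iff_isUnit_det H₀).1 hH₀.isUnit)
    rw [sub_mulVec, dotProduct_sub, e, smul_mulVec, dotProduct_smul, smul_eq_mul] at h
    linarith
  have htrace : (a • H₀ + b • (1 : Matrix (Fin d) (Fin d) ℝ))⁻¹.trace ≤ b⁻¹ * d := by
    have h := (hQ.posSemidef_inv_sub_inv_add hP.posSemidef).trace_nonneg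
    have e : (b • (1 : Matrix (Fin d) (Fin d) ℝ))⁻¹ = b⁻¹ • 1 := by
      have := Matrix.inv_smul' (1 : Matrix (Fin d) (Fin d) ℝ) (Units.mk0 b hb0.ne') (by simp)
      rw [inv_one] at this
      exact this
    rw [trace_sub, e, trace_smul, trace_one, Fintype.card_fin, smul_eq_mul, add_comm] at h
    linarith
  have h2 : (a • H₀ + b • (1 : Matrix (Fin d) (Fin d) ℝ)).trace ≤ a + b * d := by
    rw [trace_add, trace_smul, trace_smul, trace_one, Fintype.card_fin, smul_eq_mul, smul_eq_mul]
    nlinarith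
  have h3 : ε * (b⁻¹ * d) = η * (d * √ε) := by
    rw [hb, inv_div]
    field_simp
    rw [Real.sq_sqrt hε.le]
  have h4 : a⁻¹ * q ≤ η * r := by
    calc a⁻¹ * q ≤ a⁻¹ * r ^ 2 := by gcongr
      _ = η * r := by rw [ha, inv_div]; field_simp
  have h5 : η ^ 2 * (a + b * d) = η * (r + d * √ε) := by
    rw [ha, hb]; field_simp
  have h6 := mul_le_mul_of_nonneg_left htrace hε.le
  have h7 := mul_le_mul_of_nonneg_left h2 (sq_nonneg η)
  have h8 : η * (η * H.trace) ≤ η * (r + d * √ε) := by nlinarith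
  exact le_of_mul_le_mul_left h8 hη

end Regularizer

section Descent

variable {d : ℕ}

theorem grad_dotProduct (f : (Fin d → ℝ) → ℝ) (x v : Fin d → ℝ) :
    grad f x ⬝ᵥ v = fderiv ℝ f x v := by
  conv_rhs => rw [pi_eq_sum_univ' v]
  simp only [map_sum, map_smul, smul_eq_mul, dotProduct, grad]
  refine Finset.sum_congr rfl fun i _ => ?_
  rw [mul_comm]

theorem ConvexOn.sub_le_grad_dotProduct {f : (Fin d → ℝ) → ℝ} (hf : ConvexOn ℝ Set.univ f)
    (hd : Differentiable ℝ f) (x y : Fin d → ℝ) : f x - f y ≤ grad f x ⬝ᵥ (x - y) := by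
  have hconv : ConvexOn ℝ Set.univ (f ∘ AffineMap.lineMap (k := ℝ) x y) := by
    simpa using hf.comp_affineMap (AffineMap.lineMap (k := ℝ) x y)
  have hderiv : HasDerivAt (f ∘ AffineMap.lineMap (k := ℝ) x y) (fderiv ℝ f x (y - x)) 0 := by
    have h1 : HasFDerivAt f (fderiv ℝ f x) (AffineMap.lineMap x y (0 : ℝ)) := by
      simpa using (hd x).hasFDerivAt
    exact h1.comp_hasDerivAt (0 : ℝ) AffineMap.hasDerivAt_lineMap
  have h := hconv.le_slope_of_hasDerivAt (Set.mem_univ 0) (Set.mem_univ 1) zero_lt_one hderiv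
  simp [slope_def_field] at h
  rw [grad_dotProduct, map_sub]
  linarith

/-- Projecting in the `P`-norm onto a convex set does not increase the distance to its points. -/
theorem quadForm_sub_le_of_isMin {𝒳 : Set (Fin d → ℝ)} (h𝒳 : Convex ℝ 𝒳)
    {P : Matrix (Fin d) (Fin d) ℝ} (hP : P.PosSemidef) {z u y : Fin d → ℝ} (hz : z ∈ 𝒳)
    (hy : y ∈ 𝒳) (hmin : ∀ w ∈ 𝒳, (z - u) ⬝ᵥ P *ᵥ (z - u) ≤ (w - u) ⬝ᵥ P *ᵥ (w - u)) :
    (z - y) ⬝ᵥ P *ᵥ (z - y) ≤ (u - y) ⬝ᵥ P *ᵥ (u - y) := by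
  set p := z - u with hp
  set v := y - z with hv
  have hsymm := hP.isHermitian.dotProduct_mulVec_comm v p
  have hexp : ∀ s : ℝ, (p + s • v) ⬝ᵥ P *ᵥ (p + s • v) =
      p ⬝ᵥ P *ᵥ p + 2 * s * (p ⬝ᵥ P *ᵥ v) + s ^ 2 * (v ⬝ᵥ P *ᵥ v) := by
    intro s
    simp only [mulVec_add, mulVec_smul, add_dotProduct, dotProduct_add, smul_dotProduct,
      dotProduct_smul, smul_eq_mul, hsymm]
    ring
  have hpos : 0 ≤ p ⬝ᵥ P *ᵥ v := by
    have hs : ∀ s ∈ Set.Ioo (0 : ℝ) 1, 0 ≤ 2 * (p ⬝ᵥ P *ᵥ v) + s * (v ⬝ᵥ P *ᵥ v) := by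
      rintro s ⟨hs0, hs1⟩
      have h := hmin (z + s • v) (h𝒳.add_smul_sub_mem hz hy ⟨hs0.le, hs1.le⟩)
      rw [show z + s • v - u = p + s • v by rw [hp]; abel, hexp] at h
      refine nonneg_of_mul_nonneg_right (a := s) ?_ hs0
      nlinarith
    have hlim : Filter.Tendsto (fun s : ℝ => 2 * (p ⬝ᵥ P *ᵥ v) + s * (v ⬝ᵥ P *ᵥ v))
        (nhdsWithin 0 (Set.Ioi 0)) (nhds (2 * (p ⬝ᵥ P *ᵥ v) + 0 * (v ⬝ᵥ P *ᵥ v))) :=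
      (Continuous.tendsto (by fun_prop) 0).mono_left nhdsWithin_le_nhds
    have := ge_of_tendsto hlim
      (Filter.eventually_of_mem (Ioo_mem_nhdsGT zero_lt_one) hs)
    linarith
  have e1 : z - y = (-1 : ℝ) • v := by rw [hv]; simp
  have e2 : u - y = (-1 : ℝ) • (p + (1 : ℝ) • v) := by rw [hp, hv]; simp
  rw [e1, e2]
  have := hexp 1
  have hpp := hP.quadForm_nonneg p
  simp only [mulVec_smul, smul_dotProduct, dotProduct_smul, smul_eq_mul] at this ⊢
  linarith

theorem Matrix.PosDef.quadForm_sub_inv_mulVec {P : Matrix (Fin d) (Fin d) ℝ} (hP : P.PosDef)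
    (e g : Fin d → ℝ) :
    (e - P⁻¹ *ᵥ g) ⬝ᵥ P *ᵥ (e - P⁻¹ *ᵥ g) =
      e ⬝ᵥ P *ᵥ e - 2 * (g ⬝ᵥ e) + g ⬝ᵥ P⁻¹ *ᵥ g := by
  have hdet := (isUnit_iff_isUnit_det P).1 hP.isUnit
  have h1 : P *ᵥ (P⁻¹ *ᵥ g) = g := by rw [mulVec_mulVec, mul_nonsing_inv _ hdet, one_mulVec]
  have h2 := hP.isHermitian.dotProduct_mulVec_comm (P⁻¹ *ᵥ g) e
  simp only [mulVec_sub, sub_dotProduct, dotProduct_sub, h1] at h2 ⊢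
  rw [h2, dotProduct_comm e g, dotProduct_comm (P⁻¹ *ᵥ g) g]
  ring

end Descent

section Regret

variable {d : ℕ} {𝓗 : Set (Matrix (Fin d) (Fin d) ℝ)} {ε η : ℝ} {𝒳 : Set (Fin d → ℝ)} {T : ℕ}
  {L : ℕ → (Fin d → ℝ) → ℝ} {x g : ℕ → Fin d → ℝ} {M H : ℕ → Matrix (Fin d) (Fin d) ℝ}

theorem AdaReg.mem (hiter : AdaReg 𝓗 ε η 𝒳 T L x g M H) {t : ℕ} (ht : 1 ≤ t) (htT : t ≤ T) :
    H t ∈ 𝓗 ∧ (H t).PosDef :=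
  let ⟨_, _, _, _, h, h', _⟩ := hiter.2.2 t ht htT
  ⟨h, h'⟩

theorem AdaReg.isMin (hiter : AdaReg 𝓗 ε η 𝒳 T L x g M H)
    {S : Subalgebra ℝ (Matrix (Fin d) (Fin d) ℝ)} (hS : ∀ A, A ∈ 𝓗 ↔ A ∈ S ∧ A.PosSemidef)
    {t : ℕ} (ht : 1 ≤ t) (htT : t ≤ T) :
    ∀ H' ∈ S, H'.PosDef →
      minner (M t) (H t)⁻¹ + η ^ 2 * (H t).trace ≤ minner (M t) H'⁻¹ + η ^ 2 * H'.trace :=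
  fun H' h h' =>
    let ⟨_, _, _, _, _, _, hmin, _⟩ := hiter.2.2 t ht htT
    hmin H' ((hS H').2 ⟨h, h'.posSemidef⟩) h'

theorem AdaReg.minner_eq (hiter : AdaReg 𝓗 ε η 𝒳 T L x g M H) {t : ℕ} (htT : t ≤ T)
    (A : Matrix (Fin d) (Fin d) ℝ) :
    minner (M t) A = ε * A.trace + ∑ s ∈ Finset.Icc 1 t, g s ⬝ᵥ A *ᵥ g s := by
  induction t with
  | zero => simp [hiter.2.1, minner]
  | succ t ih =>
    obtain ⟨_, _, _, hM, _⟩ := hiter.2.2 (t + 1) (by omega) htT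
    rw [hM, minner_add_left, minner_vecMulVec_self, Nat.add_sub_cancel, ih (by omega),
      Finset.sum_Icc_succ_top (by omega), add_assoc]

theorem AdaReg.posSemidef_sub (hiter : AdaReg 𝓗 ε η 𝒳 T L x g M H) (hη : 0 < η)
    {S : Subalgebra ℝ (Matrix (Fin d) (Fin d) ℝ)} (hS : ∀ A, A ∈ 𝓗 ↔ A ∈ S ∧ A.PosSemidef)
    {t : ℕ} (ht : 1 ≤ t) (htT : t + 1 ≤ T) : H (t + 1) - H t ∈ 𝓗 := by
  obtain ⟨h1, h2⟩ := hiter.mem ht (by omega)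
  obtain ⟨h1', h2'⟩ := hiter.mem (t := t + 1) (by omega) htT
  obtain ⟨_, _, _, hM, _⟩ := hiter.2.2 (t + 1) (by omega) htT
  rw [hS] at h1 h1' ⊢
  exact ⟨sub_mem h1'.1 h1.1, posSemidef_sub_of_isMin hη hM h2 h1.1 h2' h1'.1
    (hiter.isMin hS ht (by omega)) (hiter.isMin hS (by omega) htT)⟩

/-- One step of the online mirror descent inequality. -/
theorem AdaReg.sub_le (hiter : AdaReg 𝓗 ε η 𝒳 T L x g M H) (h𝒳 : Convex ℝ 𝒳) {y : Fin d → ℝ}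
    (hy : y ∈ 𝒳) {t : ℕ} (ht : 1 ≤ t) (htT : t ≤ T) :
    2 * (L t (x t) - L t y) ≤ (x t - y) ⬝ᵥ H t *ᵥ (x t - y) -
      (x (t + 1) - y) ⬝ᵥ H t *ᵥ (x (t + 1) - y) + g t ⬝ᵥ (H t)⁻¹ *ᵥ g t := by
  obtain ⟨hdiff, hconv, hg, -, -, hpd, -, hx, hproj⟩ := hiter.2.2 t ht htT
  have h1 := hconv.sub_le_grad_dotProduct hdiff (x t) y
  have h2 := quadForm_sub_le_of_isMin h𝒳 hpd.posSemidef hx hy hproj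
  rw [sub_right_comm, hpd.quadForm_sub_inv_mulVec] at h2
  rw [← hg] at h1
  linarith

/-- The distance terms telescope, up to the growth of the preconditioners. -/
theorem AdaReg.sum_quadForm_le (hiter : AdaReg 𝓗 ε η 𝒳 T L x g M H) (h𝓗 : WellStructured 𝓗)
    (hη : 0 < η) {y : Fin d → ℝ} {D : ℝ}
    (hD : ∀ t, 1 ≤ t → t ≤ T → hNorm 𝓗 (x t - y) ≤ D) {t : ℕ} (ht : 1 ≤ t) (htT : t ≤ T) :
    ∑ s ∈ Finset.Icc 1 t, ((x s - y) ⬝ᵥ H s *ᵥ (x s - y) -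
        (x (s + 1) - y) ⬝ᵥ H s *ᵥ (x (s + 1) - y)) ≤
      (H t).trace * D ^ 2 - (x (t + 1) - y) ⬝ᵥ H t *ᵥ (x (t + 1) - y) := by
  obtain ⟨S, hS⟩ := h𝓗.exists_subalgebra
  have hbound : ∀ t, 1 ≤ t → t ≤ T → ∀ A ∈ 𝓗,
      (x t - y) ⬝ᵥ A *ᵥ (x t - y) ≤ A.trace * D ^ 2 := fun t ht htT A hA =>
    (h𝓗.quadForm_le_trace_mul_hNorm_sq hA _).trans <|
      mul_le_mul_of_nonneg_left (pow_le_pow_left₀ (hNorm_nonneg _ _) (hD t ht htT) 2)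
        ((hS A).1 hA).2.trace_nonneg
  induction t, ht using Nat.le_induction with
  | base =>
    have := hbound 1 le_rfl htT _ (hiter.mem le_rfl htT).1
    simpa using this
  | succ t ht ih =>
    have h1 := hbound (t + 1) (by omega) htT _ (hiter.posSemidef_sub hη hS ht htT)
    rw [sub_mulVec, dotProduct_sub, trace_sub] at h1
    rw [Finset.sum_Icc_succ_top (by omega)]
    linarith [ih (by omega)]

/-- The follow-the-leader, be-the-leader bound on the gradient terms. -/
theorem AdaReg.sum_gradient_le (hiter : AdaReg 𝓗 ε η 𝒳 T L x g M H) (h𝓗 : WellStructured 𝓗)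
    (hε : 0 < ε) {t : ℕ} (ht : 1 ≤ t) (htT : t ≤ T) :
    ∑ s ∈ Finset.Icc 1 t, g s ⬝ᵥ (H s)⁻¹ *ᵥ g s ≤
      minner (M t) (H t)⁻¹ + η ^ 2 * (H t).trace := by
  obtain ⟨S, hS⟩ := h𝓗.exists_subalgebra
  induction t, ht using Nat.le_induction with
  | base =>
    have hpd := (hiter.mem le_rfl htT).2
    have h1 := mul_nonneg hε.le hpd.inv.posSemidef.trace_nonneg
    have h2 := mul_nonneg (sq_nonneg η) hpd.posSemidef.trace_nonneg
    rw [hiter.minner_eq htT]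
    simp only [Finset.Icc_self, Finset.sum_singleton]
    linarith
  | succ t ht ih =>
    have hmem := hiter.mem (t := t + 1) (by omega) htT
    have h1 := hiter.isMin hS ht (by omega) _ ((hS _).1 hmem.1).1 hmem.2
    have h2 := ih (by omega)
    rw [hiter.minner_eq (t := t) (by omega) (H (t + 1))⁻¹] at h1
    rw [hiter.minner_eq htT, Finset.sum_Icc_succ_top (by omega),
      Finset.sum_Icc_succ_top (by omega)]
    linarith

theorem AdaReg.trace_le (hiter : AdaReg 𝓗 ε η 𝒳 T L x g M H) (h𝓗 : WellStructured 𝓗)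
    (hε : 0 < ε) (hη : 0 < η) (hT : 1 ≤ T) :
    η * (H T).trace ≤ adaNorm 𝓗 T g + d * √ε := by
  obtain ⟨S, hS⟩ := h𝓗.exists_subalgebra
  rw [← sub_le_iff_le_add]
  have hmem := hiter.mem hT le_rfl
  refine le_csInf ?_ ?_
  · have hpos : (0 : ℝ) < ((d : ℝ) + 1)⁻¹ := by positivity
    have hpd : (((d : ℝ) + 1)⁻¹ • (1 : Matrix (Fin d) (Fin d) ℝ)).PosDef := PosDef.one.smul hpos
    refine ⟨_, _, (hS _).2 ⟨S.smul_mem (one_mem S) _, hpd.posSemidef⟩, hpd, ?_, rfl⟩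
    rw [trace_smul, trace_one, Fintype.card_fin, smul_eq_mul, inv_mul_le_iff₀ (by positivity)]
    linarith
  · rintro r ⟨H₀, hH₀, hpd, htr, rfl⟩
    rw [sub_le_iff_le_add]
    exact trace_le_of_isMin hε hη (hiter.minner_eq le_rfl) hmem.2 ((hS _).1 hmem.1).1
      (hiter.isMin hS hT le_rfl) hpd ((hS _).1 hH₀).1 htr

end Regret

theorem stmt_7 {d : ℕ} (𝓗 : Set (Matrix (Fin d) (Fin d) ℝ)) (h𝓗 : WellStructured 𝓗)
    (ε η : ℝ) (hε : 0 < ε) (hη : 0 < η)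
    (𝒳 : Set (Fin d → ℝ)) (h𝒳conv : Convex ℝ 𝒳) (h𝒳ne : 𝒳.Nonempty)
    (T : ℕ) (hT : 1 ≤ T) (L : ℕ → (Fin d → ℝ) → ℝ)
    (x g : ℕ → Fin d → ℝ) (M H : ℕ → Matrix (Fin d) (Fin d) ℝ)
    (hiter : AdaReg 𝓗 ε η 𝒳 T L x g M H) :
    ∀ xstar ∈ 𝒳, ∀ D : ℝ,
      D = sSup {r | ∃ t, 1 ≤ t ∧ t ≤ T ∧ r = hNorm 𝓗 (x t - xstar)} →
      ∑ t ∈ Finset.Icc 1 T, L t (x t) - ∑ t ∈ Finset.Icc 1 T, L t xstar ≤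
        (D ^ 2 / (2 * η) + η) * (adaNorm 𝓗 T g + d * Real.sqrt ε) := by
  intro y hy D hD
  obtain ⟨S, hS⟩ := h𝓗.exists_subalgebra
  have hfin : {r | ∃ t, 1 ≤ t ∧ t ≤ T ∧ r = hNorm 𝓗 (x t - y)}.Finite := by
    refine ((Set.finite_Icc 1 T).image fun t => hNorm 𝓗 (x t - y)).subset ?_
    rintro r ⟨t, h1, h2, rfl⟩
    exact ⟨t, ⟨h1, h2⟩, rfl⟩
  have hDle : ∀ t, 1 ≤ t → t ≤ T → hNorm 𝓗 (x t - y) ≤ D := fun t h1 h2 =>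
    hD ▸ le_csSup hfin.bddAbove ⟨t, h1, h2, rfl⟩
  have hmem := hiter.mem hT le_rfl
  have hdist := hiter.sum_quadForm_le h𝓗 hη hDle hT le_rfl
  have hgrad := hiter.sum_gradient_le h𝓗 hε hT le_rfl
  rw [minner_inv_eq_of_isMin hmem.2 ((hS _).1 hmem.1).1 (hiter.isMin hS hT le_rfl)] at hgrad
  have hlast := hmem.2.posSemidef.quadForm_nonneg (x (T + 1) - y)
  have hreg : 2 * (∑ t ∈ Finset.Icc 1 T, L t (x t) - ∑ t ∈ Finset.Icc 1 T, L t y) ≤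
      ∑ s ∈ Finset.Icc 1 T, ((x s - y) ⬝ᵥ H s *ᵥ (x s - y) -
        (x (s + 1) - y) ⬝ᵥ H s *ᵥ (x (s + 1) - y)) +
      ∑ s ∈ Finset.Icc 1 T, g s ⬝ᵥ (H s)⁻¹ *ᵥ g s := by
    rw [← Finset.sum_sub_distrib, Finset.mul_sum, ← Finset.sum_add_distrib]
    refine Finset.sum_le_sum fun t ht => ?_
    rw [Finset.mem_Icc] at ht
    exact hiter.sub_le h𝒳conv hy ht.1 ht.2
  have hcoef : 0 ≤ D ^ 2 / (2 * η) + η := by positivity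
  refine le_trans ?_ (mul_le_mul_of_nonneg_left (hiter.trace_le h𝓗 hε hη hT) hcoef)
  have : (D ^ 2 / (2 * η) + η) * (η * (H T).trace) =
      ((H T).trace * D ^ 2 + 2 * (η ^ 2 * (H T).trace)) / 2 := by
    field_simp
  rw [this]
  linarith
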